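/- There exist ε′ > 0 and C > 0, depending only on n, λ, Λ, such that for every short-geodesic trajectory with data (y₀, η₀, s) with 0 < s < ε′ one has 0 < T ≤ C, and the length of the projected geodesic with respect to the gas giant metric, which equals ∫₀^T √(ξ(t)² + x(t)²⟨A(x(t),y(t))η(t), η(t)⟩) dt, equals s·T and is at most C s. -/

import Mathlib

open Set

noncomputable section

/-- `quadForm M v w = ⟨M v, w⟩`, the bilinear form of the matrix `M` with respect to the
standard inner product on `ℝ^m`. -/
def quadForm {m : ℕ} (M : Matrix (Fin m) (Fin m) ℝ) (v w : Fin m → ℝ) : ℝ :=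
  ∑ i, (∑ j, M i j * v j) * w i

/-- The Euclidean norm of a vector in `ℝ^m`. -/
def euclNorm {m : ℕ} (v : Fin m → ℝ) : ℝ :=
  Real.sqrt (∑ i, v i ^ 2)

/-- Entrywise partial derivative `∂ₓ A` of a matrix-valued map in its first (scalar) variable. -/
def dxA {m : ℕ} (A : ℝ → (Fin m → ℝ) → Matrix (Fin m) (Fin m) ℝ)
    (x : ℝ) (y : Fin m → ℝ) : Matrix (Fin m) (Fin m) ℝ :=
  Matrix.of fun i j => deriv (fun x' => A x' y i j) x

/-- Entrywise partial derivative `∂_{y k} A` of a matrix-valued map in the `k`-th component of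
its second (vector) variable. -/
def dyA {m : ℕ} (A : ℝ → (Fin m → ℝ) → Matrix (Fin m) (Fin m) ℝ)
    (k : Fin m) (x : ℝ) (y : Fin m → ℝ) : Matrix (Fin m) (Fin m) ℝ :=
  Matrix.of fun i j => deriv (fun s => A x (Function.update y k s) i j) (y k)

/-- Partial derivative `∂ₓ f` of a scalar function of `(x, y)`. -/
def dxF {m : ℕ} (f : ℝ → (Fin m → ℝ) → ℝ) (x : ℝ) (y : Fin m → ℝ) : ℝ :=
  deriv (fun x' => f x' y) x

/-- Partial derivative `∂_{y k} f` of a scalar function of `(x, y)`. -/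
def dyF {m : ℕ} (f : ℝ → (Fin m → ℝ) → ℝ) (k : Fin m) (x : ℝ) (y : Fin m → ℝ) : ℝ :=
  deriv (fun s => f x (Function.update y k s)) (y k)

/-- Iterated partial derivative `∂ₓ^k f` of a scalar function of `(x, y)`. -/
def dxIter {m : ℕ} : ℕ → (ℝ → (Fin m → ℝ) → ℝ) → ℝ → (Fin m → ℝ) → ℝ
  | 0, f => f
  | (k+1), f => dxF (dxIter k f)

/-- The standing hypotheses on the data of a gas giant in `g`-boundary normal coordinates:
`n ≥ 2`, `ε ∈ (0,1]`, `U ⊆ ℝ^{n-1}` open, and `A : [0,ε) × U → ℝ^{(n-1)×(n-1)}` symmetric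
positive definite (with uniform ellipticity constants `0 < lam ≤ Lam`), extending to a `C^∞`
map on an open neighborhood of `[0,ε) × U`, with all first-order partial derivatives of all
entries bounded by `Lam`.  (`A` plays the role of the inverse boundary metric `h^{ij}` of the
gas giant metric `g = dx² + x⁻² h(x,y,dy)`.) -/
structure GasGiantData (n : ℕ) (ε : ℝ) (U : Set (Fin (n-1) → ℝ))
    (A : ℝ → (Fin (n-1) → ℝ) → Matrix (Fin (n-1)) (Fin (n-1)) ℝ)
    (lam Lam : ℝ) : Prop where
  hn : 2 ≤ n
  hε : ε ∈ Set.Ioc (0:ℝ) 1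
  hU : IsOpen U
  hlam : 0 < lam
  hlamLam : lam ≤ Lam
  hsymm : ∀ x ∈ Set.Ico (0:ℝ) ε, ∀ y ∈ U, (A x y).IsSymm
  hsmooth : ∃ W : Set (ℝ × (Fin (n-1) → ℝ)), IsOpen W ∧ Set.Ico (0:ℝ) ε ×ˢ U ⊆ W ∧
    ∀ i j, ContDiffOn ℝ (⊤ : ℕ∞) (fun p : ℝ × (Fin (n-1) → ℝ) => A p.1 p.2 i j) W
  hposdef : ∀ x ∈ Set.Ico (0:ℝ) ε, ∀ y ∈ U, ∀ v : Fin (n-1) → ℝ,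
    lam * (∑ i, v i ^ 2) ≤ quadForm (A x y) v v ∧ quadForm (A x y) v v ≤ Lam * (∑ i, v i ^ 2)
  hderivBound : ∀ x ∈ Set.Ico (0:ℝ) ε, ∀ y ∈ U,
    (∀ i j, |dxA A x y i j| ≤ Lam) ∧ (∀ k i j, |dyA A k x y i j| ≤ Lam)

/-- A Hamiltonian trajectory on the interval `I` for the gas giant Hamiltonian
`H(x,y,ξ,η) = ½ ξ² + ½ x² ⟨A(x,y)η, η⟩`: a `C¹` curve
`t ↦ (x(t), y(t), ξ(t), η(t)) ∈ [0,ε) × U × ℝ × ℝ^{n-1}` satisfying Hamilton's equations. -/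
structure IsHamTraj (n : ℕ) (ε : ℝ) (U : Set (Fin (n-1) → ℝ))
    (A : ℝ → (Fin (n-1) → ℝ) → Matrix (Fin (n-1)) (Fin (n-1)) ℝ) (I : Set ℝ)
    (x : ℝ → ℝ) (y : ℝ → Fin (n-1) → ℝ) (ξ : ℝ → ℝ) (η : ℝ → Fin (n-1) → ℝ) : Prop where
  mem : ∀ t ∈ I, x t ∈ Set.Ico (0:ℝ) ε ∧ y t ∈ U
  hx : ∀ t ∈ I, HasDerivAt x (ξ t) t
  hy : ∀ t ∈ I, ∀ i, HasDerivAt (fun t' => y t' i)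
    ((x t)^2 * ∑ j, A (x t) (y t) i j * η t j) t
  hxi : ∀ t ∈ I, HasDerivAt ξ
    (-(x t * quadForm (A (x t) (y t)) (η t) (η t))
      - (1/2) * (x t)^2 * quadForm (dxA A (x t) (y t)) (η t) (η t)) t
  heta : ∀ t ∈ I, ∀ i, HasDerivAt (fun t' => η t' i)
    (-(1/2) * (x t)^2 * quadForm (dyA A i (x t) (y t)) (η t) (η t)) t

/-- A short-geodesic trajectory with data `(y₀, η₀, s)`: a Hamiltonian trajectory on `[0,T]`,
`T > 0`, with initial value `(0, y₀, s, η₀)`, with `x(T) = 0` and `x(t) > 0` on `(0,T)`. -/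
def IsShortGeo (n : ℕ) (ε : ℝ) (U : Set (Fin (n-1) → ℝ))
    (A : ℝ → (Fin (n-1) → ℝ) → Matrix (Fin (n-1)) (Fin (n-1)) ℝ)
    (y₀ η₀ : Fin (n-1) → ℝ) (s T : ℝ)
    (x : ℝ → ℝ) (y : ℝ → Fin (n-1) → ℝ) (ξ : ℝ → ℝ) (η : ℝ → Fin (n-1) → ℝ) : Prop :=
  0 < T ∧ IsHamTraj n ε U A (Set.Icc 0 T) x y ξ η ∧
    x 0 = 0 ∧ y 0 = y₀ ∧ ξ 0 = s ∧ η 0 = η₀ ∧ x T = 0 ∧ ∀ t ∈ Set.Ioo 0 T, 0 < x t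

theorem abs_quadForm_le {m : ℕ} {M : Matrix (Fin m) (Fin m) ℝ} {K : ℝ} (hK : 0 ≤ K)
    (hM : ∀ i j, |M i j| ≤ K) (v : Fin m → ℝ) :
    |quadForm M v v| ≤ K * m * ∑ i, v i ^ 2 := by
  have hsum : |quadForm M v v| ≤ K * (∑ i, |v i|) ^ 2 := by
    unfold quadForm
    calc |∑ i, (∑ j, M i j * v j) * v i| ≤ ∑ i, |(∑ j, M i j * v j) * v i| :=
          Finset.abs_sum_le_sum_abs _ _
      _ ≤ ∑ i, (K * ∑ j, |v j|) * |v i| := by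
          refine Finset.sum_le_sum fun i _ => ?_
          rw [abs_mul, Finset.mul_sum]
          gcongr
          refine (Finset.abs_sum_le_sum_abs _ _).trans (Finset.sum_le_sum fun j _ => ?_)
          rw [abs_mul]
          gcongr
          exact hM i j
      _ = K * (∑ i, |v i|) ^ 2 := by rw [← Finset.mul_sum]; ring
  have hcs : (∑ i, |v i|) ^ 2 ≤ m * ∑ i, v i ^ 2 := by
    simpa using sq_sum_le_card_mul_sum_sq (s := Finset.univ) (f := fun i => |v i|)
  nlinarith [mul_le_mul_of_nonneg_left hcs hK]

/-- Derivative of `⟨M v, v⟩` along a curve, at a time where `M` is symmetric. -/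
theorem hasDerivAt_quadForm {m : ℕ} {M : ℝ → Matrix (Fin m) (Fin m) ℝ} {v : ℝ → Fin m → ℝ}
    {M' : Matrix (Fin m) (Fin m) ℝ} {v' : Fin m → ℝ} {t : ℝ} (hsymm : (M t).IsSymm)
    (hM : ∀ i j, HasDerivAt (fun τ => M τ i j) (M' i j) t)
    (hv : ∀ i, HasDerivAt (fun τ => v τ i) (v' i) t) :
    HasDerivAt (fun τ => quadForm (M τ) (v τ) (v τ))
      (quadForm M' (v t) (v t) + 2 * ∑ i, (∑ j, M t i j * v t j) * v' i) t := by
  have h : HasDerivAt (fun τ => quadForm (M τ) (v τ) (v τ))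
      (∑ i, ((∑ j, (M' i j * v t j + M t i j * v' j)) * v t i
        + (∑ j, M t i j * v t j) * v' i)) t :=
    HasDerivAt.fun_sum fun i _ =>
      (HasDerivAt.fun_sum fun j _ => (hM i j).fun_mul (hv j)).fun_mul (hv i)
  convert h using 1
  have hswap : ∑ i, (∑ j, M t i j * v' j) * v t i = ∑ i, (∑ j, M t i j * v t j) * v' i := by
    simp only [Finset.sum_mul]
    rw [Finset.sum_comm]
    refine Finset.sum_congr rfl fun i _ => Finset.sum_congr rfl fun j _ => ?_
    rw [hsymm.apply i j]; ring
  unfold quadForm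
  simp only [Finset.sum_add_distrib, add_mul, hswap]
  ring

/-- Chain rule for a function of `(x, y)` along a curve, in terms of its partial derivatives. -/
theorem hasDerivAt_comp_partials {m : ℕ} {f : ℝ → (Fin m → ℝ) → ℝ} {x : ℝ → ℝ}
    {y : ℝ → Fin m → ℝ} {x' : ℝ} {y' : Fin m → ℝ} {t : ℝ}
    (hf : DifferentiableAt ℝ (fun p : ℝ × (Fin m → ℝ) => f p.1 p.2) (x t, y t))
    (hx : HasDerivAt x x' t) (hy : ∀ i, HasDerivAt (fun τ => y τ i) (y' i) t) :
    HasDerivAt (fun τ => f (x τ) (y τ))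
      (dxF f (x t) (y t) * x' + ∑ k, dyF f k (x t) (y t) * y' k) t := by
  obtain ⟨L, hL⟩ := hf
  have h : HasDerivAt (fun τ => f (x τ) (y τ)) (L (x', y')) t := by
    have hc : HasDerivAt (fun τ => (x τ, y τ)) (x', y') t := hx.prodMk (hasDerivAt_pi.2 hy)
    exact hL.comp_hasDerivAt t hc
  have hdx : dxF f (x t) (y t) = L (1, 0) := by
    have hc : HasDerivAt (fun a => (a, y t)) ((1, 0) : ℝ × (Fin m → ℝ)) (x t) :=
      (hasDerivAt_id (x t)).prodMk (hasDerivAt_const _ _)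
    exact (hL.comp_hasDerivAt (x t) hc).deriv
  have hdy : ∀ k, dyF f k (x t) (y t) = L (0, Pi.single k 1) := fun k => by
    have hu : HasDerivAt (fun s => ((x t, Function.update (y t) k s) : ℝ × (Fin m → ℝ)))
        (0, Pi.single k 1) (y t k) :=
      (hasDerivAt_const _ _).prodMk (hasDerivAt_update (y t) k (y t k))
    have hL' : HasFDerivAt (fun p : ℝ × (Fin m → ℝ) => f p.1 p.2) L
        ((fun s => ((x t, Function.update (y t) k s) : ℝ × (Fin m → ℝ))) (y t k)) := by
      simpa using hL
    exact (hL'.comp_hasDerivAt (y t k) hu).deriv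
  convert h using 1
  have hsplit : ((x', y') : ℝ × (Fin m → ℝ))
      = x' • ((1, 0) : ℝ × (Fin m → ℝ))
        + ∑ k, y' k • ((0, Pi.single k 1) : ℝ × (Fin m → ℝ)) := by
    ext i
    · simp [Prod.fst_sum]
    · simp [Prod.snd_sum, Finset.sum_apply, Pi.single_apply]
  rw [hsplit, map_add, map_sum, map_smul, hdx]
  simp only [map_smul, hdy, smul_eq_mul, mul_comm]

section Trajectory

variable {n : ℕ} {ε lam Lam : ℝ} {U : Set (Fin (n-1) → ℝ)}
  {A : ℝ → (Fin (n-1) → ℝ) → Matrix (Fin (n-1)) (Fin (n-1)) ℝ} {I : Set ℝ}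
  {x : ℝ → ℝ} {y : ℝ → Fin (n-1) → ℝ} {ξ : ℝ → ℝ} {η : ℝ → Fin (n-1) → ℝ}

theorem GasGiantData.differentiableAt (hD : GasGiantData n ε U A lam Lam) {a : ℝ}
    {b : Fin (n-1) → ℝ} (ha : a ∈ Set.Ico (0:ℝ) ε) (hb : b ∈ U) (i j : Fin (n-1)) :
    DifferentiableAt ℝ (fun p : ℝ × (Fin (n-1) → ℝ) => A p.1 p.2 i j) (a, b) := by
  obtain ⟨W, hWo, hsub, hW⟩ := hD.hsmooth
  exact ((hW i j).contDiffAt (hWo.mem_nhds (hsub ⟨ha, hb⟩))).differentiableAt (by simp)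

theorem IsHamTraj.hasDerivAt_energy (hD : GasGiantData n ε U A lam Lam)
    (h : IsHamTraj n ε U A I x y ξ η) {t : ℝ} (ht : t ∈ I) :
    HasDerivAt (fun t => ξ t ^ 2 + (x t)^2 * quadForm (A (x t) (y t)) (η t) (η t)) 0 t := by
  obtain ⟨hxm, hym⟩ := h.mem t ht
  set w : Fin (n-1) → ℝ := fun i => ∑ j, A (x t) (y t) i j * η t j with hw
  set D : Fin (n-1) → ℝ := fun k => quadForm (dyA A k (x t) (y t)) (η t) (η t) with hDdef
  have hA : ∀ i j, HasDerivAt (fun τ => A (x τ) (y τ) i j)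
      ((Matrix.of fun i j => dxA A (x t) (y t) i j * ξ t
        + ∑ k, dyA A k (x t) (y t) i j * ((x t)^2 * w k) : Matrix _ _ ℝ) i j) t := fun i j =>
    hasDerivAt_comp_partials (f := fun a b => A a b i j) (hD.differentiableAt hxm hym i j)
      (h.hx t ht) (h.hy t ht)
  have hQ := hasDerivAt_quadForm (M := fun τ => A (x τ) (y τ)) (hD.hsymm _ hxm _ hym) hA
    (h.heta t ht)
  have hE := ((h.hxi t ht).fun_pow 2).fun_add (((h.hx t ht).fun_pow 2).fun_mul hQ)
  refine hE.congr_deriv ?_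
  have hq : quadForm (Matrix.of fun i j => dxA A (x t) (y t) i j * ξ t
        + ∑ k, dyA A k (x t) (y t) i j * ((x t)^2 * w k) : Matrix _ _ ℝ) (η t) (η t)
      = ξ t * quadForm (dxA A (x t) (y t)) (η t) (η t) + (x t)^2 * ∑ k, w k * D k := by
    simp only [hDdef, quadForm, Matrix.of_apply, add_mul, Finset.sum_add_distrib, Finset.mul_sum,
      Finset.sum_mul]
    congr 1
    · exact Finset.sum_congr rfl fun i _ => Finset.sum_congr rfl fun j _ => by ring
    · refine (Finset.sum_congr rfl fun i _ => Finset.sum_comm).trans (Finset.sum_comm.trans ?_)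
      exact Finset.sum_congr rfl fun k _ => Finset.sum_congr rfl fun i _ =>
        Finset.sum_congr rfl fun j _ => by ring
  have hs : ∑ i, w i * (-(1/2) * (x t)^2 * D i) = -(1/2) * (x t)^2 * ∑ k, w k * D k := by
    rw [Finset.mul_sum]
    exact Finset.sum_congr rfl fun i _ => by ring
  rw [hq]
  change _ + (_ + _ * (_ + 2 * ∑ i, w i * (-(1/2) * (x t)^2 * D i))) = 0
  rw [hs]
  push_cast
  ring

theorem IsHamTraj.energy_eq {T : ℝ} (hD : GasGiantData n ε U A lam Lam)
    (h : IsHamTraj n ε U A (Set.Icc 0 T) x y ξ η) (hx0 : x 0 = 0) {t : ℝ}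
    (ht : t ∈ Set.Icc 0 T) :
    ξ t ^ 2 + (x t)^2 * quadForm (A (x t) (y t)) (η t) (η t) = ξ 0 ^ 2 := by
  have hconst := constant_of_has_deriv_right_zero
    (fun τ hτ => (h.hasDerivAt_energy hD hτ).continuousAt.continuousWithinAt)
    (fun τ hτ => (h.hasDerivAt_energy hD (Ico_subset_Icc_self hτ)).hasDerivWithinAt) t ht
  simpa [hx0] using hconst

end Trajectory

/-- Sturm comparison: a function `u` vanishing at `0` whose second derivative is at most `-c² u`
is not positive at `π / c`. -/
theorem nonpos_of_deriv2_le {c : ℝ} (hc : 0 < c) {u v a : ℝ → ℝ} (hu0 : u 0 = 0)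
    (hu : ∀ t ∈ Set.Icc 0 (Real.pi / c), HasDerivAt u (v t) t)
    (hv : ∀ t ∈ Set.Icc 0 (Real.pi / c), HasDerivAt v (a t) t)
    (ha : ∀ t ∈ Set.Icc 0 (Real.pi / c), a t ≤ -c ^ 2 * u t) :
    u (Real.pi / c) ≤ 0 := by
  set W : ℝ → ℝ := fun t => v t * Real.sin (c * t) - c * u t * Real.cos (c * t) with hWdef
  have hL : 0 ≤ Real.pi / c := (div_pos Real.pi_pos hc).le
  have hW : ∀ t ∈ Set.Icc 0 (Real.pi / c),
      HasDerivAt W ((a t + c ^ 2 * u t) * Real.sin (c * t)) t := fun t ht => by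
    have hlin : HasDerivAt (fun τ : ℝ => c * τ) c t := by
      simpa using (hasDerivAt_id t).const_mul c
    have := ((hv t ht).fun_mul hlin.sin).fun_sub (((hu t ht).const_mul c).fun_mul hlin.cos)
    exact this.congr_deriv (by ring)
  have hanti : AntitoneOn W (Set.Icc 0 (Real.pi / c)) := by
    refine antitoneOn_of_deriv_nonpos (convex_Icc _ _)
      (fun t ht => (hW t ht).continuousAt.continuousWithinAt)
      (fun t ht => (hW t (interior_subset ht)).differentiableAt.differentiableWithinAt)
      fun t ht => ?_
    have ht' := interior_subset ht
    rw [(hW t ht').deriv]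
    refine mul_nonpos_of_nonpos_of_nonneg (by linarith [ha t ht']) ?_
    refine Real.sin_nonneg_of_nonneg_of_le_pi (mul_nonneg hc.le ht'.1) ?_
    have := (le_div_iff₀ hc).1 ht'.2
    linarith
  have := hanti (left_mem_Icc.2 hL) (right_mem_Icc.2 hL) hL
  have hcL : c * (Real.pi / c) = Real.pi := by field_simp
  simp only [hWdef, hcL, hu0, Real.sin_pi, Real.cos_pi] at this
  norm_num at this
  nlinarith

section ShortGeodesics

variable {n : ℕ} {ε lam Lam : ℝ} {U : Set (Fin (n-1) → ℝ)}
  {A : ℝ → (Fin (n-1) → ℝ) → Matrix (Fin (n-1)) (Fin (n-1)) ℝ}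
  {x : ℝ → ℝ} {y : ℝ → Fin (n-1) → ℝ} {ξ : ℝ → ℝ} {η : ℝ → Fin (n-1) → ℝ} {T : ℝ}

theorem IsHamTraj.abs_eta_sub_le (hD : GasGiantData n ε U A lam Lam)
    (h : IsHamTraj n ε U A (Set.Icc 0 T) x y ξ η) (hx0 : x 0 = 0) {t : ℝ}
    (ht : t ∈ Set.Icc 0 T) (i : Fin (n-1)) :
    |η t i - η 0 i| ≤ Lam * (n-1 : ℕ) / (2 * lam) * ξ 0 ^ 2 * t := by
  have hLam : 0 < Lam := hD.hlam.trans_le hD.hlamLam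
  have key := norm_image_sub_le_of_norm_deriv_le_segment' (f := fun τ => η τ i)
    (C := Lam * (n-1 : ℕ) / (2 * lam) * ξ 0 ^ 2)
    (fun τ hτ => (h.heta τ hτ i).hasDerivWithinAt) (fun τ hτ => ?_) t ht
  · simpa using key
  have hτ' := Ico_subset_Icc_self hτ
  obtain ⟨hxm, hym⟩ := h.mem τ hτ'
  have hd := abs_quadForm_le hLam.le ((hD.hderivBound _ hxm _ hym).2 i) (η τ)
  have hp := (hD.hposdef _ hxm _ hym (η τ)).1
  have hN : (x τ)^2 * ∑ i, η τ i ^ 2 ≤ ξ 0 ^ 2 / lam := by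
    rw [le_div_iff₀ hD.hlam]
    have := mul_le_mul_of_nonneg_left hp (sq_nonneg (x τ))
    nlinarith [h.energy_eq hD hx0 hτ', sq_nonneg (ξ τ)]
  rw [Real.norm_eq_abs, abs_mul, abs_mul, abs_neg, abs_of_pos (by norm_num : (0:ℝ) < 1/2),
    abs_of_nonneg (sq_nonneg (x τ))]
  calc 1/2 * (x τ)^2 * |quadForm (dyA A i (x τ) (y τ)) (η τ) (η τ)|
      ≤ 1/2 * (x τ)^2 * (Lam * (n-1 : ℕ) * ∑ i, η τ i ^ 2) := by gcongr
    _ = 1/2 * (Lam * (n-1 : ℕ)) * ((x τ)^2 * ∑ i, η τ i ^ 2) := by ring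
    _ ≤ 1/2 * (Lam * (n-1 : ℕ)) * (ξ 0 ^ 2 / lam) := by gcongr
    _ = Lam * (n-1 : ℕ) / (2 * lam) * ξ 0 ^ 2 := by field_simp

theorem IsHamTraj.x_le (hD : GasGiantData n ε U A lam Lam)
    (h : IsHamTraj n ε U A (Set.Icc 0 T) x y ξ η) (hx0 : x 0 = 0) (hξ0 : 0 ≤ ξ 0) {t : ℝ}
    (ht : t ∈ Set.Icc 0 T) : x t ≤ ξ 0 * t := by
  have key := norm_image_sub_le_of_norm_deriv_le_segment' (f := x) (C := ξ 0)
    (fun τ hτ => (h.hx τ hτ).hasDerivWithinAt) (fun τ hτ => ?_) t ht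
  · rw [hx0, Real.norm_eq_abs] at key
    linarith [le_abs_self (x t - 0)]
  have hτ' := Ico_subset_Icc_self hτ
  obtain ⟨hxm, hym⟩ := h.mem τ hτ'
  have hp := (hD.hposdef _ hxm _ hym (η τ)).1
  have hQ : 0 ≤ quadForm (A (x τ) (y τ)) (η τ) (η τ) :=
    (mul_nonneg hD.hlam.le (Finset.sum_nonneg fun i _ => sq_nonneg _)).trans hp
  rw [Real.norm_eq_abs]
  refine abs_le_of_sq_le_sq ?_ hξ0
  nlinarith [h.energy_eq hD hx0 hτ', mul_nonneg (sq_nonneg (x τ)) hQ]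

/-- As long as the covector `η` has moved little, the `x`-component satisfies
the concavity estimate `dξ/dt ≤ -(lam / (8 Lam)) x`. -/
theorem IsHamTraj.xi_deriv_le (hD : GasGiantData n ε U A lam Lam)
    (h : IsHamTraj n ε U A (Set.Icc 0 T) x y ξ η) {δ t : ℝ} (ht : t ∈ Set.Icc 0 T)
    (hη0 : 1 ≤ Lam * ∑ i, η 0 i ^ 2) (hη : ∀ i, |η t i - η 0 i| ≤ δ)
    (hδ : 4 * Lam * (n-1 : ℕ) * δ ^ 2 ≤ 1) (hx : x t * (Lam * (n-1 : ℕ)) ≤ lam) :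
    -(x t * quadForm (A (x t) (y t)) (η t) (η t))
      - (1/2) * (x t)^2 * quadForm (dxA A (x t) (y t)) (η t) (η t)
      ≤ -(lam / (8 * Lam)) * x t := by
  have hLam : 0 < Lam := hD.hlam.trans_le hD.hlamLam
  obtain ⟨hxm, hym⟩ := h.mem t ht
  have hx0 : 0 ≤ x t := hxm.1
  set N := ∑ i, η t i ^ 2 with hN
  set Q := quadForm (A (x t) (y t)) (η t) (η t)
  set D := quadForm (dxA A (x t) (y t)) (η t) (η t)
  have hN0 : 0 ≤ N := Finset.sum_nonneg fun i _ => sq_nonneg _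
  have hQ : lam * N ≤ Q := (hD.hposdef _ hxm _ hym (η t)).1
  have hd : |D| ≤ Lam * (n-1 : ℕ) * N :=
    abs_quadForm_le hLam.le (hD.hderivBound _ hxm _ hym).1 (η t)
  have hsum : ∑ i, η 0 i ^ 2 ≤ 2 * N + 2 * ((n-1 : ℕ) * δ ^ 2) := by
    have : ∑ i, η 0 i ^ 2 ≤ ∑ i, (2 * η t i ^ 2 + 2 * δ ^ 2) := by
      refine Finset.sum_le_sum fun i _ => ?_
      have := sq_le_sq' (abs_le.1 (hη i)).1 (abs_le.1 (hη i)).2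
      nlinarith [sq_nonneg (2 * η t i - η 0 i)]
    simpa [Finset.sum_add_distrib, ← Finset.mul_sum, hN, mul_left_comm] using this
  have hNlow : 1 ≤ 4 * Lam * N := by
    nlinarith [mul_le_mul_of_nonneg_left hsum hLam.le]
  have hxD : x t * |D| ≤ Q := by
    calc x t * |D| ≤ x t * (Lam * (n-1 : ℕ) * N) := by gcongr
      _ = x t * (Lam * (n-1 : ℕ)) * N := by ring
      _ ≤ lam * N := by gcongr
      _ ≤ Q := hQ
  have hlow : lam / (8 * Lam) ≤ Q / 2 := by
    rw [div_le_iff₀ (by positivity)]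
    nlinarith [mul_le_mul_of_nonneg_left hNlow hD.hlam.le, mul_le_mul_of_nonneg_left hQ hLam.le]
  have h1 : -(x t * D) ≤ Q := by
    nlinarith [mul_le_mul_of_nonneg_left (neg_abs_le D) hx0]
  nlinarith [mul_le_mul_of_nonneg_left h1 hx0, mul_le_mul_of_nonneg_left hlow hx0]

theorem IsHamTraj.exit_time_le (hD : GasGiantData n ε U A lam Lam)
    (h : IsHamTraj n ε U A (Set.Icc 0 T) x y ξ η) (hx0 : x 0 = 0) (hξ0 : 0 ≤ ξ 0)
    (hη0 : quadForm (A 0 (y 0)) (η 0) (η 0) = 1) (hT : 0 < T)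
    (hpos : ∀ t ∈ Set.Ioo 0 T, 0 < x t) {L : ℝ}
    (hL : L = Real.pi / Real.sqrt (lam / (8 * Lam)))
    (hsmall₁ : 4 * Lam * (n-1 : ℕ) * (Lam * (n-1 : ℕ) / (2 * lam) * ξ 0 ^ 2 * L) ^ 2 ≤ 1)
    (hsmall₂ : ξ 0 * L * (Lam * (n-1 : ℕ)) ≤ lam) : T ≤ L := by
  have hlam := hD.hlam
  have hLam : 0 < Lam := hlam.trans_le hD.hlamLam
  have hc : 0 < Real.sqrt (lam / (8 * Lam)) := Real.sqrt_pos.2 (by positivity)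
  have hL0 : 0 < L := hL ▸ div_pos Real.pi_pos hc
  have h0 : (0:ℝ) ∈ Set.Icc 0 T := left_mem_Icc.2 hT.le
  by_contra! hlt
  have hη0' : 1 ≤ Lam * ∑ i, η 0 i ^ 2 := by
    obtain ⟨hxm, hym⟩ := h.mem 0 h0
    have := (hD.hposdef _ hxm _ hym (η 0)).2
    rwa [hx0, hη0] at this
  have hsub : ∀ t ∈ Set.Icc 0 L, t ∈ Set.Icc 0 T := fun t ht => ⟨ht.1, ht.2.trans hlt.le⟩
  refine (hpos L ⟨hL0, hlt⟩).not_ge ?_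
  rw [hL] at hsub ⊢
  refine nonpos_of_deriv2_le hc hx0 (fun t ht => h.hx t (hsub t ht))
    (fun t ht => h.hxi t (hsub t ht)) fun t ht => ?_
  rw [Real.sq_sqrt (by positivity)]
  rw [← hL] at ht hsub
  refine h.xi_deriv_le hD (hsub t ht) hη0'
    (δ := Lam * (n-1 : ℕ) / (2 * lam) * ξ 0 ^ 2 * L) (fun i => ?_) hsmall₁ ?_
  · refine (h.abs_eta_sub_le hD hx0 (hsub t ht) i).trans ?_
    gcongr
    exact ht.2
  · refine le_trans ?_ hsmall₂
    gcongr
    exact (h.x_le hD hx0 hξ0 (hsub t ht)).trans (by gcongr; exact ht.2)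

end ShortGeodesics

/-- short geodesics have uniformly bounded exit time `0 < T ≤ C`, and their
`g`-length `∫₀ᵀ √(ξ² + x²⟨Aη,η⟩) dt` equals `s·T` and is at most `C s`; `ε'`, `C` depend only
on `n`, `lam`, `Lam`. -/
theorem stmt_7 (n : ℕ) (hn : 2 ≤ n) (lam Lam : ℝ) (hlam : 0 < lam) (hll : lam ≤ Lam) :
    ∃ ε' > (0:ℝ), ∃ C > (0:ℝ),
      ∀ (ε : ℝ) (U : Set (Fin (n-1) → ℝ))
        (A : ℝ → (Fin (n-1) → ℝ) → Matrix (Fin (n-1)) (Fin (n-1)) ℝ),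
        GasGiantData n ε U A lam Lam →
        ∀ (y₀ η₀ : Fin (n-1) → ℝ) (s T : ℝ)
          (x : ℝ → ℝ) (y : ℝ → Fin (n-1) → ℝ) (ξ : ℝ → ℝ) (η : ℝ → Fin (n-1) → ℝ),
          y₀ ∈ U → quadForm (A 0 y₀) η₀ η₀ = 1 → 0 < s → s < ε' →
          IsShortGeo n ε U A y₀ η₀ s T x y ξ η →
          0 < T ∧ T ≤ C ∧
          (∫ t in (0:ℝ)..T,
              Real.sqrt (ξ t ^ 2 + (x t)^2 * quadForm (A (x t) (y t)) (η t) (η t)))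
            = s * T ∧
          s * T ≤ C * s := by
  have hLam : 0 < Lam := hlam.trans_le hll
  have hm : (0:ℝ) < (n-1 : ℕ) := by exact_mod_cast Nat.sub_pos_of_lt hn
  obtain ⟨L, hL⟩ : ∃ L, L = Real.pi / Real.sqrt (lam / (8 * Lam)) := ⟨_, rfl⟩
  have hL0 : 0 < L := hL ▸ div_pos Real.pi_pos (Real.sqrt_pos.2 (by positivity))
  set P : ℝ := 4 * Lam * (n-1 : ℕ) * (Lam * (n-1 : ℕ) / (2 * lam) * L) ^ 2 with hP
  set R : ℝ := L * (Lam * (n-1 : ℕ)) with hR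
  have hP0 : 0 < P := by positivity
  have hR0 : 0 < R := by positivity
  refine ⟨min 1 (min (1 / P) (lam / R)), by positivity, L, hL0, ?_⟩
  rintro ε U A hD y₀ η₀ s T x y ξ η - hη₀ hs hsε ⟨hT, h, hx0, rfl, rfl, rfl, -, hpos⟩
  have hs1 := hsε.trans_le (min_le_left _ _)
  have hs2 := (lt_div_iff₀ hP0).1
    (hsε.trans_le ((min_le_right _ _).trans (min_le_left _ _)))
  have hs3 := (lt_div_iff₀ hR0).1
    (hsε.trans_le ((min_le_right _ _).trans (min_le_right _ _)))
  have hTL : T ≤ L := by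
    refine h.exit_time_le hD hx0 hs.le hη₀ hT hpos hL ?_ (by rw [mul_assoc]; exact hs3.le)
    have hs4 : ξ 0 ^ 4 ≤ ξ 0 := pow_le_of_le_one hs.le hs1.le (by norm_num)
    calc 4 * Lam * (n-1 : ℕ) * (Lam * (n-1 : ℕ) / (2 * lam) * ξ 0 ^ 2 * L) ^ 2
        = ξ 0 ^ 4 * P := by rw [hP]; ring
      _ ≤ ξ 0 * P := by gcongr
      _ ≤ 1 := hs2.le
  refine ⟨hT, hTL, ?_, by rw [mul_comm]; gcongr⟩
  rw [intervalIntegral.integral_congr (g := fun _ => ξ 0) fun t ht => ?_]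
  · simp [mul_comm]
  · rw [Set.uIcc_of_le hT.le] at ht
    simp only [h.energy_eq hD hx0 ht, Real.sqrt_sq hs.le]
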